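/- For every positive integer n > 2 there exists a prime number p satisfying n < p < 5(n+3)/4. -/

import Mathlib

open Finset ArithmeticFunction Chebyshev
open scoped Nat

/-- The upper bound of Stirling type for `log n!`. -/
lemma log_factorial_le {n : ℕ} (hn : 1 ≤ n) :
    Real.log (n ! : ℝ) ≤ n * Real.log n - n + Real.log n + 1 := by
  induction n, hn using Nat.le_induction with
  | base => simp
  | succ n hn ih =>
    have hn0 : (0 : ℝ) < n := by exact_mod_cast hn
    rw [Nat.factorial_succ, Nat.cast_mul, Real.log_mul (by positivity) (by positivity)]
    push_cast
    have h := Real.log_le_sub_one_of_pos (x := (n : ℝ) / (n + 1)) (by positivity)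
    rw [Real.log_div (by positivity) (by positivity)] at h
    have h2 : (n : ℝ) / (n + 1) - 1 = -(1 / (n + 1)) := by field_simp; ring
    rw [h2] at h
    have h3 : ((n : ℝ) + 1) * (Real.log n - Real.log (n + 1)) ≤ -1 := by
      calc _ ≤ ((n : ℝ) + 1) * (-(1 / (n + 1))) := by gcongr
        _ = -1 := by field_simp
    linarith

/-- The lower bound of Stirling type for `log n!`. -/
lemma le_log_factorial {n : ℕ} (hn : 1 ≤ n) :
    n * Real.log n - n ≤ Real.log (n ! : ℝ) := by
  have h := Stirling.le_log_factorial_stirling (n := n) (by lia)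
  have h1 : 0 ≤ Real.log n := Real.log_natCast_nonneg n
  have h2 : 0 ≤ Real.log (2 * Real.pi) := Real.log_nonneg (by linarith [Real.pi_gt_three])
  linarith

/-- Legendre's formula in logarithmic form, summed over any range containing `Ioc 0 M`. -/
lemma log_factorial_eq_sum_vonMangoldt {M N : ℕ} (h : M ≤ N) :
    Real.log (M ! : ℝ) = ∑ d ∈ Ioc 0 N, Λ d * ((M / d : ℕ) : ℝ) := by
  have h1 : Real.log (M ! : ℝ) = ∑ d ∈ Ioc 0 M, Λ d * ((M / d : ℕ) : ℝ) := by
    rw [← sum_Ioc_mul_zeta_eq_sum, vonMangoldt_mul_zeta]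
    clear h
    induction M with
    | zero => simp
    | succ M ih =>
      rw [Finset.sum_Ioc_succ_top (by lia), ← ih, Nat.factorial_succ, Nat.cast_mul,
        Real.log_mul (by positivity) (by positivity), log_apply, add_comm]
  rw [h1]
  refine Finset.sum_subset (Ioc_subset_Ioc_right h) fun d hd hd' ↦ ?_
  simp only [mem_Ioc] at hd hd'
  rw [Nat.div_eq_of_lt (by lia)]
  simp

/-- The logarithm of Chebyshev's integer `(30k)! k! / ((15k)! (10k)! (6k)!)`. -/
noncomputable def chebyshevLog (k : ℕ) : ℝ :=
  Real.log ((30 * k) ! : ℝ) + Real.log (k ! : ℝ) - Real.log ((15 * k) ! : ℝ)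
    - Real.log ((10 * k) ! : ℝ) - Real.log ((6 * k) ! : ℝ)

lemma chebyshevLog_eq_sum (k : ℕ) :
    chebyshevLog k = ∑ d ∈ Ioc 0 (30 * k), Λ d *
      (((30 * k / d : ℕ) : ℝ) + ((30 * k / d / 30 : ℕ) : ℝ) - ((30 * k / d / 2 : ℕ) : ℝ)
        - ((30 * k / d / 3 : ℕ) : ℝ) - ((30 * k / d / 5 : ℕ) : ℝ)) := by
  have h (a b d : ℕ) (ha : 0 < a) : b * k / d = a * b * k / d / a := by
    rw [Nat.div_div_eq_div_mul, mul_comm d a, mul_assoc, Nat.mul_div_mul_left _ _ ha]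
  rw [chebyshevLog, log_factorial_eq_sum_vonMangoldt le_rfl,
    log_factorial_eq_sum_vonMangoldt (M := k) (N := 30 * k) (by lia),
    log_factorial_eq_sum_vonMangoldt (M := 15 * k) (N := 30 * k) (by lia),
    log_factorial_eq_sum_vonMangoldt (M := 10 * k) (N := 30 * k) (by lia),
    log_factorial_eq_sum_vonMangoldt (M := 6 * k) (N := 30 * k) (by lia),
    ← sum_add_distrib, ← sum_sub_distrib, ← sum_sub_distrib, ← sum_sub_distrib]
  refine sum_congr rfl fun d _ ↦ ?_
  have h30 := h 30 1 d (by simp)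
  rw [one_mul] at h30
  rw [h30, h 2 15 d (by simp), h 3 10 d (by simp), h 5 6 d (by simp)]
  norm_num only
  ring

lemma chebyshevLog_le_psi (k : ℕ) : chebyshevLog k ≤ psi ((30 * k : ℕ) : ℝ) := by
  rw [chebyshevLog_eq_sum, psi, Nat.floor_natCast]
  refine sum_le_sum fun d _ ↦ ?_
  refine mul_le_of_le_one_right vonMangoldt_nonneg ?_
  generalize 30 * k / d = q
  have : q + q / 30 ≤ 1 + q / 2 + q / 3 + q / 5 := by lia
  have : ((q + q / 30 : ℕ) : ℝ) ≤ (1 + q / 2 + q / 3 + q / 5 : ℕ) := by exact_mod_cast this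
  push_cast only [Nat.cast_add, Nat.cast_one] at this
  linarith

lemma psi_le_chebyshevLog_add (k : ℕ) :
    psi ((30 * k : ℕ) : ℝ) ≤ chebyshevLog k + psi ((5 * k : ℕ) : ℝ) := by
  have h5 : psi ((5 * k : ℕ) : ℝ) = ∑ d ∈ Ioc 0 (30 * k), if d ≤ 5 * k then Λ d else 0 := by
    rw [psi, Nat.floor_natCast, ← sum_filter]
    refine sum_congr ?_ fun _ _ ↦ rfl
    ext d
    simp only [mem_Ioc, mem_filter]
    lia
  rw [h5, chebyshevLog_eq_sum, psi, Nat.floor_natCast, ← sum_add_distrib]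
  refine sum_le_sum fun d hd ↦ ?_
  rw [mem_Ioc] at hd
  have hq1 : 1 ≤ 30 * k / d := (Nat.one_le_div_iff hd.1).2 hd.2
  have hq6 : ¬ d ≤ 5 * k → 30 * k / d < 6 := fun h ↦
    (Nat.div_lt_iff_lt_mul hd.1).2 (by lia)
  generalize 30 * k / d = q at hq1 hq6
  have hΛ : 0 ≤ Λ d := vonMangoldt_nonneg
  split_ifs with h
  · have : q / 2 + q / 3 + q / 5 ≤ q + q / 30 := by lia
    have : ((q / 2 + q / 3 + q / 5 : ℕ) : ℝ) ≤ (q + q / 30 : ℕ) := by exact_mod_cast this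
    push_cast only [Nat.cast_add] at this
    have := mul_nonneg hΛ (sub_nonneg.2 this)
    linarith
  · have := hq6 h
    have : 1 + q / 2 + q / 3 + q / 5 ≤ q + q / 30 := by lia
    have : ((1 + q / 2 + q / 3 + q / 5 : ℕ) : ℝ) ≤ (q + q / 30 : ℕ) := by exact_mod_cast this
    push_cast only [Nat.cast_add, Nat.cast_one] at this
    have := mul_nonneg hΛ (sub_nonneg.2 this)
    linarith

/-- The growth rate of `chebyshevLog`. -/
noncomputable def chebyshevRate : ℝ := 14 * Real.log 2 + 9 * Real.log 3 + 5 * Real.log 5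

lemma log_six_eq : Real.log 6 = Real.log 2 + Real.log 3 := by
  rw [← Real.log_mul (by norm_num) (by norm_num)]; norm_num

lemma log_ten_eq : Real.log 10 = Real.log 2 + Real.log 5 := by
  rw [← Real.log_mul (by norm_num) (by norm_num)]; norm_num

lemma log_fifteen_eq : Real.log 15 = Real.log 3 + Real.log 5 := by
  rw [← Real.log_mul (by norm_num) (by norm_num)]; norm_num

lemma log_thirty_eq : Real.log 30 = Real.log 2 + Real.log 3 + Real.log 5 := by
  rw [← Real.log_mul (by norm_num) (by norm_num), ← Real.log_mul (by norm_num) (by norm_num)]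
  norm_num

lemma chebyshevLog_le {k : ℕ} (hk : 1 ≤ k) :
    chebyshevLog k ≤ k * chebyshevRate + 2 * Real.log (30 * k) + 2 := by
  have hk0 : (k : ℝ) ≠ 0 := by positivity
  have h30 := log_factorial_le (n := 30 * k) (by lia)
  have h1 := log_factorial_le hk
  have h15 := le_log_factorial (n := 15 * k) (by lia)
  have h10 := le_log_factorial (n := 10 * k) (by lia)
  have h6 := le_log_factorial (n := 6 * k) (by lia)
  push_cast at h30 h15 h10 h6
  have hpos : 0 ≤ Real.log 30 := Real.log_nonneg (by norm_num)
  rw [Real.log_mul (by norm_num) hk0] at h30 h15 h10 h6 ⊢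
  rw [log_thirty_eq] at h30 hpos ⊢
  rw [log_fifteen_eq] at h15
  rw [log_ten_eq] at h10
  rw [log_six_eq] at h6
  rw [chebyshevLog, chebyshevRate]
  linarith

lemma le_chebyshevLog {k : ℕ} (hk : 1 ≤ k) :
    k * chebyshevRate - 3 * Real.log (30 * k) - 3 ≤ chebyshevLog k := by
  have hk0 : (k : ℝ) ≠ 0 := by positivity
  have h30 := le_log_factorial (n := 30 * k) (by lia)
  have h1 := le_log_factorial hk
  have h15 := log_factorial_le (n := 15 * k) (by lia)
  have h10 := log_factorial_le (n := 10 * k) (by lia)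
  have h6 := log_factorial_le (n := 6 * k) (by lia)
  push_cast at h30 h15 h10 h6
  have h2 : 0 ≤ Real.log 2 := Real.log_nonneg (by norm_num)
  have h3 : 0 ≤ Real.log 3 := Real.log_nonneg (by norm_num)
  have h5 : 0 ≤ Real.log 5 := Real.log_nonneg (by norm_num)
  rw [Real.log_mul (by norm_num) hk0] at h30 h15 h10 h6 ⊢
  rw [log_thirty_eq] at h30 ⊢
  rw [log_fifteen_eq] at h15
  rw [log_ten_eq] at h10
  rw [log_six_eq] at h6
  rw [chebyshevLog, chebyshevRate]
  linarith

lemma psi_thirty_mul_le {k : ℕ} (hk : 1 ≤ k) :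
    psi ((30 * k : ℕ) : ℝ) ≤ k * chebyshevRate + 2 * Real.log (30 * k) + 2
      + psi ((30 * ((k + 5) / 6) : ℕ) : ℝ) := by
  have h : psi ((5 * k : ℕ) : ℝ) ≤ psi ((30 * ((k + 5) / 6) : ℕ) : ℝ) :=
    psi_mono (Nat.cast_le.2 (by lia))
  linarith [psi_le_chebyshevLog_add k, chebyshevLog_le hk]

lemma theta_le_of_forall_not_prime {x y : ℕ} (h : ∀ p, p.Prime → x < p → y < p) :
    theta y ≤ theta x := by
  rw [theta, theta, Nat.floor_natCast, Nat.floor_natCast]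
  refine sum_le_sum_of_subset_of_nonneg (fun p hp ↦ ?_) fun p hp _ ↦ Real.log_natCast_nonneg p
  simp only [mem_filter, mem_Ioc] at hp ⊢
  have := h p hp.2
  exact ⟨⟨hp.1.1, by lia⟩, hp.2⟩

/-- An upper bound for `ψ` from four rounds of Chebyshev's recursion. -/
lemma psi_le_of_large {n : ℕ} (hn : 29 ≤ n) :
    psi n ≤ chebyshevRate * (259 / 6480 * n + 7) + 8 * Real.log (2 * n) + 8
      + (Real.log 4 + 4) * (n / 1296 + 60) := by
  have hL : 0 ≤ chebyshevRate := by unfold chebyshevRate; positivity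
  have hstep (k : ℕ) (hk : 1 ≤ k) (hkn : 30 * k ≤ 2 * n) :
      psi ((30 * k : ℕ) : ℝ) ≤ k * chebyshevRate + 2 * Real.log (2 * n) + 2
        + psi ((30 * ((k + 5) / 6) : ℕ) : ℝ) := by
    have : Real.log (30 * k) ≤ Real.log (2 * n) :=
      Real.log_le_log (by positivity) (by exact_mod_cast hkn)
    linarith [psi_thirty_mul_le hk]
  have hcast (k : ℕ) : (((k + 5) / 6 : ℕ) : ℝ) ≤ (k + 5) / 6 := by
    exact_mod_cast Nat.cast_div_le (m := k + 5) (n := 6) (α := ℝ)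
  obtain ⟨k0, hk0⟩ : ∃ k, k = (n + 29) / 30 := ⟨_, rfl⟩
  obtain ⟨k1, hk1⟩ : ∃ k, k = (k0 + 5) / 6 := ⟨_, rfl⟩
  obtain ⟨k2, hk2⟩ : ∃ k, k = (k1 + 5) / 6 := ⟨_, rfl⟩
  obtain ⟨k3, hk3⟩ : ∃ k, k = (k2 + 5) / 6 := ⟨_, rfl⟩
  obtain ⟨k4, hk4⟩ : ∃ k, k = (k3 + 5) / 6 := ⟨_, rfl⟩
  have s0 := hstep k0 (by lia) (by lia)
  have s1 := hstep k1 (by lia) (by lia)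
  have s2 := hstep k2 (by lia) (by lia)
  have s3 := hstep k3 (by lia) (by lia)
  have c0 : (k0 : ℝ) ≤ (n + 29) / 30 := by
    rw [hk0]; exact_mod_cast Nat.cast_div_le (m := n + 29) (n := 30) (α := ℝ)
  have c1 := hcast k0
  have c2 := hcast k1
  have c3 := hcast k2
  have c4 := hcast k3
  rw [← hk1] at s0 c1
  rw [← hk2] at s1 c2
  rw [← hk3] at s2 c3
  rw [← hk4] at s3 c4
  have hn0 : psi n ≤ psi ((30 * k0 : ℕ) : ℝ) := psi_mono (Nat.cast_le.2 (by lia))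
  have h4 : psi ((30 * k4 : ℕ) : ℝ) ≤ (Real.log 4 + 4) * (n / 1296 + 60) := by
    refine (psi_le_const_mul_self (by positivity)).trans ?_
    have : 0 ≤ Real.log 4 := Real.log_nonneg (by norm_num)
    gcongr
    push_cast
    linarith
  have hsum : (k0 + k1 + k2 + k3 : ℝ) * chebyshevRate
      ≤ (259 / 6480 * n + 7) * chebyshevRate :=
    mul_le_mul_of_nonneg_right (by linarith) hL
  linarith

lemma le_theta_thirty_mul {m : ℕ} (hm : 1 ≤ m) :
    m * chebyshevRate - 3 * Real.log (30 * m) - 3 - 2 * √(30 * m) * Real.log (30 * m)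
      ≤ theta ((30 * m : ℕ) : ℝ) := by
  have hm1 : (1 : ℝ) ≤ m := by exact_mod_cast hm
  have h := psi_sub_theta_le (x := ((30 * m : ℕ) : ℝ)) (by push_cast; linarith)
  have h2 := chebyshevLog_le_psi m
  have h3 := le_chebyshevLog hm
  push_cast at h h2 ⊢
  linarith

lemma psi_lt_theta_of_large {n : ℕ} (hn : 2 ^ 20 ≤ n) :
    psi n < theta ((30 * (n / 24) : ℕ) : ℝ) := by
  have hup := psi_le_of_large (n := n) (by lia)
  obtain ⟨m, hm⟩ : ∃ m, m = n / 24 := ⟨_, rfl⟩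
  rw [← hm]
  have hlow := le_theta_thirty_mul (m := m) (by lia)
  have hm0 : (0 : ℝ) < m := by exact_mod_cast (by lia : 0 < m)
  have hmup : (30 * m : ℝ) ≤ 5 / 4 * n := by
    have : (24 * m : ℝ) ≤ n := by exact_mod_cast (by lia : 24 * m ≤ n)
    linarith
  have hmlow : (n : ℝ) / 24 - 1 ≤ m := by
    have : (n : ℝ) ≤ 24 * m + 24 := by exact_mod_cast (by lia : n ≤ 24 * m + 24)
    linarith
  obtain ⟨s, hs⟩ : ∃ s, s = √(n : ℝ) := ⟨_, rfl⟩
  have hss : (n : ℝ) = s ^ 2 := by rw [hs, Real.sq_sqrt (by positivity)]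
  have hs1 : 1024 ≤ s := by
    rw [hs]
    refine Real.le_sqrt_of_sq_le ?_
    norm_num at hn ⊢
    exact_mod_cast hn
  have hlog2 := Real.log_two_lt_d9
  have hlogs : Real.log s ≤ s / 1024 + 6 := by
    have h := Real.log_le_sub_one_of_pos (x := s / 2 ^ 10) (by positivity)
    rw [Real.log_div (by positivity) (by positivity), Real.log_pow] at h
    norm_num at h
    linarith
  have hl : Real.log (2 * n) ≤ s / 512 + 13 := by
    rw [hss, Real.log_mul (by norm_num) (by positivity), Real.log_pow]
    push_cast
    linarith
  have hlm : Real.log (30 * m) ≤ s / 512 + 13 := by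
    refine (Real.log_le_log (by positivity) ?_).trans hl
    linarith [show (0 : ℝ) ≤ n by positivity]
  have hsm : √(30 * m : ℝ) ≤ 1.12 * s := by
    refine Real.sqrt_le_iff.2 ⟨by positivity, ?_⟩
    nlinarith
  have hprod : 2 * √(30 * m : ℝ) * Real.log (30 * m) ≤ 2 * (1.12 * s) * (s / 512 + 13) := by
    have : 0 ≤ Real.log (30 * m) := by exact_mod_cast Real.log_natCast_nonneg (30 * m)
    gcongr
  have hlog4 : Real.log 4 ≤ 1.4 := by rw [Real.log_four_eq]; linarith
  have htail : (Real.log 4 + 4) * ((n : ℝ) / 1296 + 60) ≤ 5.4 * (n / 1296 + 60) := by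
    gcongr
    linarith
  have hL1 : 27 ≤ chebyshevRate := by
    unfold chebyshevRate; linarith [Real.log_two_gt_d9, Real.log_three_gt_d9, Real.log_five_gt_d9]
  have hmL : ((n : ℝ) / 24 - 1) * chebyshevRate ≤ m * chebyshevRate := by gcongr
  have hmain : 27 * (11 / 6480 * (n : ℝ) - 8) ≤ chebyshevRate * (11 / 6480 * n - 8) := by
    gcongr
    rw [hss]
    nlinarith
  have hprod' : 2 * (1.12 * s) * (s / 512 + 13) = 2.24 / 512 * n + 29.12 * s := by
    rw [hss]; ring
  have hns : 1024 * s ≤ n := by rw [hss]; nlinarith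
  linarith

lemma exists_prime_of_large {n : ℕ} (hn : 2 ^ 20 ≤ n) :
    ∃ p : ℕ, p.Prime ∧ n < p ∧ 4 * p < 5 * (n + 3) := by
  by_contra! h
  have h1 := theta_le_of_forall_not_prime (x := n) (y := 30 * (n / 24)) fun p hp hnp ↦ by
    have := h p hp hnp
    lia
  linarith [psi_lt_theta_of_large hn, theta_le_psi n]

lemma exists_prime_descend {n : ℕ} (q p : ℕ) (hp : p.Prime) (hpq : 4 * p < 5 * (q + 3))
    (h : n < q → ∃ p : ℕ, p.Prime ∧ n < p ∧ 4 * p < 5 * (n + 3)) (hn : n < p) :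
    ∃ p : ℕ, p.Prime ∧ n < p ∧ 4 * p < 5 * (n + 3) := by
  by_cases hnq : n < q
  · exact h hnq
  · exact ⟨p, hp, hn, by lia⟩

lemma exists_prime_of_small {n : ℕ} (h2 : 2 < n) (hn : n < 2 ^ 20) :
    ∃ p : ℕ, p.Prime ∧ n < p ∧ 4 * p < 5 * (n + 3) := by
  have hn' : n < 1225787 := by lia
  clear hn
  revert hn'
  refine exists_prime_descend 980641 1225787 (by norm_num) (by norm_num) ?_
  refine exists_prime_descend 784513 980641 (by norm_num) (by norm_num) ?_
  refine exists_prime_descend 627611 784513 (by norm_num) (by norm_num) ?_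
  refine exists_prime_descend 502087 627611 (by norm_num) (by norm_num) ?_
  refine exists_prime_descend 401671 502087 (by norm_num) (by norm_num) ?_
  refine exists_prime_descend 321341 401671 (by norm_num) (by norm_num) ?_
  refine exists_prime_descend 257077 321341 (by norm_num) (by norm_num) ?_
  refine exists_prime_descend 205663 257077 (by norm_num) (by norm_num) ?_
  refine exists_prime_descend 164531 205663 (by norm_num) (by norm_num) ?_
  refine exists_prime_descend 131641 164531 (by norm_num) (by norm_num) ?_
  refine exists_prime_descend 105331 131641 (by norm_num) (by norm_num) ?_
  refine exists_prime_descend 84263 105331 (by norm_num) (by norm_num) ?_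
  refine exists_prime_descend 67427 84263 (by norm_num) (by norm_num) ?_
  refine exists_prime_descend 53939 67427 (by norm_num) (by norm_num) ?_
  refine exists_prime_descend 43151 53939 (by norm_num) (by norm_num) ?_
  refine exists_prime_descend 34519 43151 (by norm_num) (by norm_num) ?_
  refine exists_prime_descend 27617 34519 (by norm_num) (by norm_num) ?_
  refine exists_prime_descend 22093 27617 (by norm_num) (by norm_num) ?_
  refine exists_prime_descend 17683 22093 (by norm_num) (by norm_num) ?_
  refine exists_prime_descend 14159 17683 (by norm_num) (by norm_num) ?_
  refine exists_prime_descend 11329 14159 (by norm_num) (by norm_num) ?_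
  refine exists_prime_descend 9067 11329 (by norm_num) (by norm_num) ?_
  refine exists_prime_descend 7253 9067 (by norm_num) (by norm_num) ?_
  refine exists_prime_descend 5801 7253 (by norm_num) (by norm_num) ?_
  refine exists_prime_descend 4639 5801 (by norm_num) (by norm_num) ?_
  refine exists_prime_descend 3709 4639 (by norm_num) (by norm_num) ?_
  refine exists_prime_descend 2971 3709 (by norm_num) (by norm_num) ?_
  refine exists_prime_descend 2393 2971 (by norm_num) (by norm_num) ?_
  refine exists_prime_descend 1913 2393 (by norm_num) (by norm_num) ?_
  refine exists_prime_descend 1531 1913 (by norm_num) (by norm_num) ?_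
  refine exists_prime_descend 1231 1531 (by norm_num) (by norm_num) ?_
  refine exists_prime_descend 983 1231 (by norm_num) (by norm_num) ?_
  refine exists_prime_descend 787 983 (by norm_num) (by norm_num) ?_
  refine exists_prime_descend 631 787 (by norm_num) (by norm_num) ?_
  refine exists_prime_descend 509 631 (by norm_num) (by norm_num) ?_
  refine exists_prime_descend 409 509 (by norm_num) (by norm_num) ?_
  refine exists_prime_descend 331 409 (by norm_num) (by norm_num) ?_
  refine exists_prime_descend 263 331 (by norm_num) (by norm_num) ?_
  refine exists_prime_descend 211 263 (by norm_num) (by norm_num) ?_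
  refine exists_prime_descend 173 211 (by norm_num) (by norm_num) ?_
  refine exists_prime_descend 137 173 (by norm_num) (by norm_num) ?_
  refine exists_prime_descend 107 137 (by norm_num) (by norm_num) ?_
  refine exists_prime_descend 83 107 (by norm_num) (by norm_num) ?_
  refine exists_prime_descend 67 83 (by norm_num) (by norm_num) ?_
  refine exists_prime_descend 53 67 (by norm_num) (by norm_num) ?_
  refine exists_prime_descend 41 53 (by norm_num) (by norm_num) ?_
  refine exists_prime_descend 31 41 (by norm_num) (by norm_num) ?_
  refine exists_prime_descend 23 31 (by norm_num) (by norm_num) ?_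
  refine exists_prime_descend 17 23 (by norm_num) (by norm_num) ?_
  refine exists_prime_descend 11 17 (by norm_num) (by norm_num) ?_
  refine exists_prime_descend 7 11 (by norm_num) (by norm_num) ?_
  refine exists_prime_descend 3 7 (by norm_num) (by norm_num) ?_
  intro h
  lia

theorem stmt_1 (n : ℕ) (hn : 2 < n) :
    ∃ p : ℕ, p.Prime ∧ (n : ℚ) < p ∧ (p : ℚ) < 5 * (n + 3) / 4 := by
  obtain ⟨p, hp, hnp, hpn⟩ : ∃ p : ℕ, p.Prime ∧ n < p ∧ 4 * p < 5 * (n + 3) := by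
    rcases lt_or_ge n (2 ^ 20) with h | h
    · exact exists_prime_of_small hn h
    · exact exists_prime_of_large h
  refine ⟨p, hp, by exact_mod_cast hnp, ?_⟩
  rw [lt_div_iff₀ (by norm_num), mul_comm]
  exact_mod_cast hpn
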